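/- arXiv:2007.16042 — 4 statements merged into one kernel-verified Lean document; each statement's English description precedes it below -/
import Mathlib

section
/- For all natural numbers k ≤ m, the VC-dimension of the edge relation on the Johnson graph J(m,k) is at most 4; that is, no set of 5 vertices of J(m,k) is shattered by the edge relation. -/
open SimpleGraph

/-- The Johnson graph `J(m,k)`. -/
def johnsonGraph (m k : ℕ) : SimpleGraph {s : Finset (Fin m) // s.card = k} where
  Adj u v := (symmDiff u.1 v.1).card = 2
  symm := by
    constructor
    intro u v h
    rwa [symmDiff_comm]
  loopless := by
    constructor
    intro u h
    simp [symmDiff_self, Finset.bot_eq_empty] at h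

/-- `A` is shattered by the (open) neighbourhoods of `G`. -/
def edgeShatters {V : Type*} (G : SimpleGraph V) (A : Set V) : Prop :=
  ∀ B ⊆ A, ∃ w, A ∩ G.neighborSet w = B

/-- The VC-dimension of the edge relation of `G`. -/
noncomputable def edgeVCDim {V : Type*} (G : SimpleGraph V) : ℕ :=
  sSup {n | ∃ A : Finset V, A.card = n ∧ edgeShatters G ↑A}

lemma jvc_adj {α : Type*} [DecidableEq α] (w u v : Finset α) (k : ℕ) (hw : w.card = k)
    (hu : u.card = k) (hv : v.card = k) (x y : α) (hx : w \ u = {x}) (hy : u \ w = {y}) :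
    (symmDiff v u).card = 2 ↔
      (w \ v).card = (if x ∈ w \ v then 1 else 0) + (if y ∈ v \ w then 1 else 0) := by
  have e1 : (symmDiff v u).card = (v \ u).card + (u \ v).card := by
    rw [symmDiff_def, Finset.sup_eq_union, Finset.card_union_of_disjoint]
    exact disjoint_sdiff_sdiff
  have e2 := Finset.card_sdiff_add_card_inter v u
  have e3 := Finset.card_sdiff_add_card_inter u v
  have e4 := Finset.card_sdiff_add_card_inter w v
  rw [Finset.inter_comm u v] at e3
  have hxw : x ∈ w ∧ x ∉ u := by
    have : x ∈ w \ u := by simp [hx]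
    simpa using this
  have hyu : y ∈ u ∧ y ∉ w := by
    have : y ∈ u \ w := by simp [hy]
    simpa using this
  have hmem : ∀ z, z ∈ u ↔ (z = y ∨ (z ∈ w ∧ z ≠ x)) := by
    intro z
    have h1 := Finset.ext_iff.1 hx z
    have h2 := Finset.ext_iff.1 hy z
    simp at h1 h2
    grind
  have e5 : (v ∩ u).card + (if x ∈ v then 1 else 0) = (w ∩ v).card + (if y ∈ v then 1 else 0) := by
    have a1 : (w ∩ v).card = ((w ∩ v).erase x).card + (if x ∈ v then 1 else 0) := by
      split_ifs with h
      · rw [Finset.card_erase_add_one]; simp [h, hxw.1]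
      · rw [Finset.erase_eq_of_notMem]; simp; simp [h]
    have a2 : (v ∩ u).card = ((w ∩ v).erase x).card + (if y ∈ v then 1 else 0) := by
      split_ifs with h
      · rw [← Finset.card_insert_of_notMem (a := y)]
        · congr 1; ext z; simp [hmem]; grind
        · simp [hyu.2]
      · congr 1; ext z; simp [hmem]; grind
    omega
  have c1 : (x ∈ w \ v) ↔ x ∉ v := by simp [hxw.1]
  have c2 : (y ∈ v \ w) ↔ y ∈ v := by simp [hyu.2]
  simp only [c1, c2]
  split_ifs at e5 ⊢ <;> omega

def jvcP {α ι : Type*} [DecidableEq α] (x y : ι → α) (S : Set ι) : Prop :=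
  (∃ a b, ∀ j, j ∈ S ↔ ¬ (x j = a ↔ y j = b)) ∨
  (∃ a a' b b', ∀ j, j ∈ S ↔ ((x j = a ∨ x j = a') ∧ (y j = b ∨ y j = b')))

lemma jvc_P {α ι : Type*} [DecidableEq α] (x y : ι → α) (S : Set ι) (hne : S.Nonempty)
    (hne' : S ≠ Set.univ) (D E : Finset α) (hDE : D.card = E.card)
    (h : ∀ j, j ∈ S ↔ D.card = (if x j ∈ D then 1 else 0) + (if y j ∈ E then 1 else 0)) :
    jvcP x y S := by
  obtain ⟨j0, hj0⟩ := hne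
  have hle : D.card ≤ 2 := by
    have := (h j0).1 hj0
    split_ifs at this <;> omega
  interval_cases hc : D.card
  · exfalso
    apply hne'
    ext j
    rw [h j]
    have h1 := Finset.card_eq_zero.1 hc
    have h2 := Finset.card_eq_zero.1 hDE.symm
    simp [h1, h2]
  · left
    obtain ⟨a, rfl⟩ := Finset.card_eq_one.1 hc
    obtain ⟨b, rfl⟩ := Finset.card_eq_one.1 hDE.symm
    refine ⟨a, b, fun j => ?_⟩
    rw [h j]
    clear h hj0 hc hDE hne'
    simp only [Finset.mem_singleton]
    split_ifs with h1 h2 h2 <;> simp [h1, h2]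
  · right
    obtain ⟨a, a', _, rfl⟩ := Finset.card_eq_two.1 hc
    obtain ⟨b, b', _, rfl⟩ := Finset.card_eq_two.1 hDE.symm
    refine ⟨a, a', b, b', fun j => ?_⟩
    rw [h j]
    clear h hj0
    simp only [Finset.mem_insert, Finset.mem_singleton]
    split_ifs <;> simp_all

/-- no row with three cells -/
lemma jvc_row {α ι : Type*} [DecidableEq α] (x y : ι → α)
    (hinj : ∀ i j, x i = x j → y i = y j → i = j)
    (hP : ∀ S : Set ι, S.Nonempty → S ≠ Set.univ → jvcP x y S)
    (p q r s t : ι) (hd : [p, q, r, s, t].Nodup)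
    (h1 : x p = x q) (h2 : x p = x r) : False := by
  simp at hd
  have key : ∀ S : Set ι, p ∈ S → q ∈ S → r ∈ S → S ≠ Set.univ →
      ∃ b, ∀ j, j ∈ S ↔ ¬ (x j = x p ↔ y j = b) := by
    intro S hp hq hr hS
    rcases hP S ⟨p, hp⟩ hS with ⟨a, b, h⟩ | ⟨a, a', b, b', h⟩
    · have := h p; have := h q; have := h r
      have := hinj p q; have := hinj p r; have := hinj q r
      have : x p = a := by grind
      subst this
      exact ⟨b, h⟩
    · exfalso
      have := h p; have := h q; have := h r
      have := hinj p q; have := hinj p r; have := hinj q r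
      grind
  have ne : ∀ (S : Set ι) j, j ∉ S → S ≠ Set.univ := fun S j h h' => h (h' ▸ Set.mem_univ j)
  obtain ⟨b0, k0⟩ := key {p, q, r} (by simp) (by simp) (by simp) (ne _ s (by simp; grind))
  obtain ⟨b1, k1⟩ := key {p, q, r, s} (by simp) (by simp) (by simp) (ne _ t (by simp; grind))
  obtain ⟨b2, k2⟩ := key {p, q, r, t} (by simp) (by simp) (by simp) (ne _ s (by simp; grind))
  simp only [Set.mem_insert_iff, Set.mem_singleton_iff] at k0 k1 k2
  have s0 := k0 s; have s1 := k1 s; have s2 := k2 s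
  have t0 := k0 t; have t1 := k1 t; have t2 := k2 t
  have hst := hinj s t
  have hns : x s ≠ x p := by grind
  have hnt : x t ≠ x p := by grind
  have hyst : y s ≠ y t := by grind
  have r1 : ∀ q r, x p = x q → x p = x r → [p, q, r, s, t].Nodup →
      (y s = y q ∨ y t = y q) := by
    intro q r hq hr hd
    simp at hd
    have := hinj p q hq
    rcases hP {p, q, s, t} ⟨p, by simp⟩ (ne _ r (by simp; grind)) with ⟨a, b, h⟩ | ⟨a, a', b, b', h⟩
    · exfalso
      simp only [Set.mem_insert_iff, Set.mem_singleton_iff] at h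
      have := h p; have := h q; have := h s; have := h t
      grind
    · simp only [Set.mem_insert_iff, Set.mem_singleton_iff] at h
      have := h p; have := h q; have := h s; have := h t
      grind
  have hpq := hinj p q h1
  have hpr := hinj p r h2
  have hqr := hinj q r
  have r2 : ∀ q r, x p = x q → x p = x r → [p, q, r, s, t].Nodup →
      (y s = y p ∨ y t = y p) := by
    intro q r hq hr hd
    simp at hd
    have := hinj p q hq
    rcases hP {p, q, s, t} ⟨p, by simp⟩ (ne _ r (by simp; grind)) with ⟨a, b, h⟩ | ⟨a, a', b, b', h⟩
    · exfalso
      simp only [Set.mem_insert_iff, Set.mem_singleton_iff] at h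
      have := h p; have := h q; have := h s; have := h t
      grind
    · simp only [Set.mem_insert_iff, Set.mem_singleton_iff] at h
      have := h p; have := h q; have := h s; have := h t
      grind
  have a1 := r1 q r h1 h2 (by simp; grind)
  have a2 := r1 r q h2 h1 (by simp; grind)
  have a3 := r2 q r h1 h2 (by simp; grind)
  grind

lemma jvcP_swap {α ι : Type*} [DecidableEq α] (x y : ι → α) (S : Set ι) (h : jvcP x y S) :
    jvcP y x S := by
  rcases h with ⟨a, b, h⟩ | ⟨a, a', b, b', h⟩
  · left; exact ⟨b, a, fun j => by rw [h j]; tauto⟩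
  · right; exact ⟨b, b', a, a', fun j => by rw [h j]; tauto⟩


lemma jvc_labeled {α ι : Type*} [DecidableEq α] (x y : ι → α)
    (hinj : ∀ i j, x i = x j → y i = y j → i = j)
    (hP : ∀ S : Set ι, S.Nonempty → S ≠ Set.univ → jvcP x y S)
    (hX : ∀ i j k, [i, j, k].Nodup → x i = x j → x i = x k → False)
    (hY : ∀ i j k, [i, j, k].Nodup → y i = y j → y i = y k → False)
    (p q r s t : ι) (hd : [p, q, r, s, t].Nodup)
    (hxp : x p = x q) (hyr : y r = y s)
    (hpr : y p ≠ y r) (hqr : y q ≠ y r) : False := by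
  have ne : ∀ (S : Set ι) j, j ∉ S → S ≠ Set.univ := fun S j h h' => h (h' ▸ Set.mem_univ j)
  have main : ∀ p q, [p, q, r, s, t].Nodup → x p = x q → y p ≠ y r → y p = y t := by
    intro p q hd hxp hpr
    have x1 := hX p q r (by simp at hd ⊢; grind) hxp
    have x2 := hX p q s (by simp at hd ⊢; grind) hxp
    have x3 := hX p q t (by simp at hd ⊢; grind) hxp
    have y1 := hY r s t (by simp at hd ⊢; grind) hyr
    simp at hd
    rcases hP {p, r, s, t} ⟨p, by simp⟩ (ne _ q (by simp; grind)) with ⟨a, b, h⟩ | ⟨a, a', b, b', h⟩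
    · simp only [Set.mem_insert_iff, Set.mem_singleton_iff] at h
      have hp := h p; have hr := h r; have hs := h s; have ht := h t
      have hrs := hinj r s
      grind
    · simp only [Set.mem_insert_iff, Set.mem_singleton_iff] at h
      have hp := h p; have hr := h r; have hs := h s; have ht := h t
      have hrs := hinj r s
      grind
  have m1 := main p q hd hxp hpr
  have m2 := main q p (by simp at hd ⊢; grind) hxp.symm hqr
  have := hinj p q hxp (m1.trans m2.symm)
  simp at hd
  grind

lemma jvc_cross {α ι : Type*} [DecidableEq α] (x y : ι → α)
    (hinj : ∀ i j, x i = x j → y i = y j → i = j)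
    (hP : ∀ S : Set ι, S.Nonempty → S ≠ Set.univ → jvcP x y S)
    (hX : ∀ i j k, [i, j, k].Nodup → x i = x j → x i = x k → False)
    (hY : ∀ i j k, [i, j, k].Nodup → y i = y j → y i = y k → False)
    (p q r s t : ι) (hd : [p, q, r, s, t].Nodup) (a b : α)
    (h : ∀ j, (j = p ∨ j = q ∨ j = r ∨ j = s) → ¬ (x j = a ↔ y j = b)) : False := by
  have L := jvc_labeled x y hinj hP hX hY
  have L' : ∀ p q r s t : ι, [p, q, r, s, t].Nodup → x p = a → x q = a → y r = b → y s = b →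
      y p ≠ b → y q ≠ b → False := by
    intro p q r s t hd h1 h2 h3 h4 h5 h6
    exact L p q r s t hd (by simp [*]) (by simp [*]) (by simp [*]) (by simp [*])
  have X' : ∀ i j k, [i, j, k].Nodup → x i = a → x j = a → x k = a → False :=
    fun i j k hd h1 h2 h3 => hX i j k hd (by simp [*]) (by simp [*])
  have Y' : ∀ i j k, [i, j, k].Nodup → y i = b → y j = b → y k = b → False :=
    fun i j k hd h1 h2 h3 => hY i j k hd (by simp [*]) (by simp [*])
  have hp := h p (by simp)
  have hq := h q (by simp)
  have hr := h r (by simp)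
  have hs := h s (by simp)
  have x1 := X' p q r (by simp at hd ⊢; grind)
  have x2 := X' p q s (by simp at hd ⊢; grind)
  have x3 := X' p r s (by simp at hd ⊢; grind)
  have x4 := X' q r s (by simp at hd ⊢; grind)
  have y1 := Y' p q r (by simp at hd ⊢; grind)
  have y2 := Y' p q s (by simp at hd ⊢; grind)
  have y3 := Y' p r s (by simp at hd ⊢; grind)
  have y4 := Y' q r s (by simp at hd ⊢; grind)
  have l1 := L' p q r s t (by simp at hd ⊢; grind)
  have l2 := L' p r q s t (by simp at hd ⊢; grind)
  have l3 := L' p s q r t (by simp at hd ⊢; grind)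
  have l4 := L' q r p s t (by simp at hd ⊢; grind)
  have l5 := L' q s p r t (by simp at hd ⊢; grind)
  have l6 := L' r s p q t (by simp at hd ⊢; grind)
  clear L L' X' Y' hX hY h hP hinj hd
  by_cases c1 : x p = a <;> by_cases c2 : x q = a <;> by_cases c3 : x r = a <;>
    by_cases c4 : x s = a <;> simp_all

lemma jvc_comb {α : Type*} [DecidableEq α] (x y : Fin 5 → α)
    (hinj : ∀ i j, x i = x j → y i = y j → i = j)
    (hP : ∀ S : Set (Fin 5), S.Nonempty → S ≠ Set.univ → jvcP x y S) : False := by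
  have ex : ∀ i j k : Fin 5, [i, j, k].Nodup → ∃ l m, [i, j, k, l, m].Nodup := by decide
  have hX : ∀ i j k, [i, j, k].Nodup → x i = x j → x i = x k → False := by
    intro i j k hd h1 h2
    obtain ⟨l, m, hd'⟩ := ex i j k hd
    exact jvc_row x y hinj hP i j k l m hd' h1 h2
  have hY : ∀ i j k, [i, j, k].Nodup → y i = y j → y i = y k → False := by
    intro i j k hd h1 h2
    obtain ⟨l, m, hd'⟩ := ex i j k hd
    exact jvc_row y x (fun i j a b => hinj i j b a)
      (fun S h h' => jvcP_swap _ _ _ (hP S h h')) i j k l m hd' h1 h2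
  have ne : ∀ (S : Set (Fin 5)) j, j ∉ S → S ≠ Set.univ := fun S j h h' => h (h' ▸ Set.mem_univ j)
  rcases hP {0, 1, 2, 3} ⟨0, by simp⟩ (ne _ 4 (by simp)) with ⟨a, b, h⟩ | ⟨a, a', b, b', h⟩
  · exact jvc_cross x y hinj hP hX hY 0 1 2 3 4 (by decide) a b (fun j hj => (h j).1 (by simpa using hj))
  rcases hP {1, 2, 3, 4} ⟨1, by simp⟩ (ne _ 0 (by simp)) with ⟨c, d, g⟩ | ⟨c, c', d, d', g⟩
  · exact jvc_cross x y hinj hP hX hY 1 2 3 4 0 (by decide) c d (fun j hj => (g j).1 (by simpa using hj))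
  have h0 := (h 0).1 (by simp)
  have h1 := (h 1).1 (by simp)
  have h2 := (h 2).1 (by simp)
  have h3 := (h 3).1 (by simp)
  have g1 := (g 1).1 (by simp)
  have g2 := (g 2).1 (by simp)
  have g3 := (g 3).1 (by simp)
  have g4 := (g 4).1 (by simp)
  have x1 := hX 0 1 2 (by decide)
  have x2 := hX 0 1 3 (by decide)
  have x3 := hX 0 2 3 (by decide)
  have x4 := hX 1 2 3 (by decide)
  have y4 := hY 1 2 3 (by decide)
  have hm : x 4 = a ∨ x 4 = a' := by grind
  have hm' : y 4 = b ∨ y 4 = b' := by grind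
  have := (h 4).2 ⟨hm, hm'⟩
  simp at this

lemma jvc_five (m k : ℕ) (A : Finset {s : Finset (Fin m) // s.card = k}) (hA : A.card = 5) :
    ¬ edgeShatters (johnsonGraph m k) ↑A := by
  intro hsh
  let e : Fin 5 ≃ A := (A.equivFinOfCardEq hA).symm
  let u : Fin 5 → {s : Finset (Fin m) // s.card = k} := fun i => (e i).1
  have huA : ∀ i, u i ∈ A := fun i => (e i).2
  have hui : Function.Injective u := Subtype.val_injective.comp e.injective
  have hS : ∀ S : Set (Fin 5), ∃ w : {s : Finset (Fin m) // s.card = k},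
      ∀ j, j ∈ S ↔ (symmDiff w.1 (u j).1).card = 2 := by
    intro S
    obtain ⟨w, hw⟩ := hsh (u '' S) (by rintro _ ⟨i, _, rfl⟩; exact huA i)
    refine ⟨w, fun j => ?_⟩
    have h := Set.ext_iff.1 hw (u j)
    rw [hui.mem_set_image] at h
    rw [← h]
    simp [huA, johnsonGraph]
  obtain ⟨w, hw⟩ := hS Set.univ
  have hc : ∀ j, (w.1 \ (u j).1).card = 1 ∧ ((u j).1 \ w.1).card = 1 := by
    intro j
    have h := (hw j).1 trivial
    rw [symmDiff_def, Finset.sup_eq_union, Finset.card_union_of_disjoint disjoint_sdiff_sdiff] at h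
    have e2 := Finset.card_sdiff_add_card_inter w.1 (u j).1
    have e3 := Finset.card_sdiff_add_card_inter (u j).1 w.1
    rw [Finset.inter_comm] at e3
    have := w.2
    have := (u j).2
    omega
  have hx : ∀ j, ∃ x, w.1 \ (u j).1 = {x} := fun j => Finset.card_eq_one.1 (hc j).1
  have hy : ∀ j, ∃ y, (u j).1 \ w.1 = {y} := fun j => Finset.card_eq_one.1 (hc j).2
  choose x hx using hx
  choose y hy using hy
  refine jvc_comb x y ?_ ?_
  · intro i j h1 h2
    apply hui
    apply Subtype.ext
    have a1 : w.1 \ (u i).1 = w.1 \ (u j).1 := by rw [hx, hx, h1]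
    have a2 : (u i).1 \ w.1 = (u j).1 \ w.1 := by rw [hy, hy, h2]
    ext z
    have b1 := Finset.ext_iff.1 a1 z
    have b2 := Finset.ext_iff.1 a2 z
    simp only [Finset.mem_sdiff] at b1 b2
    tauto
  · intro S hne hne'
    obtain ⟨v, hv⟩ := hS S
    refine jvc_P x y S hne hne' (w.1 \ v.1) (v.1 \ w.1) ?_ ?_
    · have e2 := Finset.card_sdiff_add_card_inter w.1 v.1
      have e3 := Finset.card_sdiff_add_card_inter v.1 w.1
      rw [Finset.inter_comm] at e3
      have := w.2
      have := v.2
      omega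
    · intro j
      rw [hv j]
      exact jvc_adj w.1 (u j).1 v.1 k w.2 (u j).2 v.2 (x j) (y j) (hx j) (hy j)

lemma jvc_mono {V : Type*} (G : SimpleGraph V) (A B : Set V) (hBA : B ⊆ A)
    (h : edgeShatters G A) : edgeShatters G B := by
  intro C hC
  obtain ⟨w, hw⟩ := h C (hC.trans hBA)
  refine ⟨w, ?_⟩
  ext z
  have := Set.ext_iff.1 hw z
  have h1 := @hBA z
  have h2 := @hC z
  simp only [Set.mem_inter_iff] at this ⊢
  tauto

/-- The VC-dimension of the edge relation of a Johnson graph is at most `4`: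
no set of `5` vertices is shattered. -/
theorem johnson_vc_dim_le_four (m k : ℕ) (hk : k ≤ m) :
    edgeVCDim (johnsonGraph m k) ≤ 4 ∧
      ∀ A : Finset {s : Finset (Fin m) // s.card = k}, A.card = 5 →
        ¬ edgeShatters (johnsonGraph m k) ↑A := by
  refine ⟨?_, jvc_five m k⟩
  unfold edgeVCDim
  apply csSup_le'
  rintro n ⟨A, rfl, hA⟩
  by_contra hlt
  obtain ⟨B, hBA, hB⟩ := Finset.exists_subset_card_eq (show 5 ≤ A.card by omega)
  exact jvc_five m k B hB (jvc_mono _ _ _ (by exact_mod_cast hBA) hA)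
end

section
/- For natural numbers k ≤ m, the VC-dimension of the edge relation on the Johnson graph J(m,k) equals 4 if and only if 1 < k < m−1 and the binomial coefficient C(m,k) is at least 16. -/
open SimpleGraph

lemma sdiff_card_comm' {α : Type*} [DecidableEq α] {u v : Finset α} (h : u.card = v.card) :
    (u \ v).card = (v \ u).card := by
  have h1 := Finset.card_sdiff_add_card_inter u v
  have h2 := Finset.card_sdiff_add_card_inter v u
  rw [Finset.inter_comm] at h2
  omega

lemma symm_card {α : Type*} [DecidableEq α] {u v : Finset α} (h : u.card = v.card) :
    (symmDiff u v).card = 2 ↔ (u \ v).card = 1 := by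
  have h1 : (symmDiff u v).card = (u \ v).card + (v \ u).card := by
    rw [symmDiff_def, Finset.sup_eq_union, Finset.card_union_of_disjoint]
    exact disjoint_sdiff_sdiff
  have := sdiff_card_comm' h
  omega

lemma common_nbr {α : Type*} [DecidableEq α] {u v c : Finset α} (huv : u.card = v.card)
    (huc : u.card = c.card) (hne : u ≠ v) (hna : (symmDiff u v).card ≠ 2)
    (h1 : (symmDiff c u).card = 2) (h2 : (symmDiff c v).card = 2) :
    (u \ v).card = 2 ∧ (v \ u).card = 2 ∧
      ∃ x ∈ u \ v, ∃ y ∈ v \ u, c = insert y (u.erase x) := by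
  rw [Ne, symm_card huv] at hna
  rw [symm_card huc.symm] at h1
  rw [symm_card (huc.symm.trans huv)] at h2
  have h1' := sdiff_card_comm' huc
  have h2' := sdiff_card_comm' (huc.symm.trans huv)
  have h3 := sdiff_card_comm' huv
  have hs : u \ v ⊆ (u \ c) ∪ (c \ v) := by intro z; simp; tauto
  have hs' : v \ u ⊆ (v \ c) ∪ (c \ u) := by intro z; simp; tauto
  have h0 : (u \ v).card ≠ 0 := by
    intro h
    rw [Finset.card_eq_zero, Finset.sdiff_eq_empty_iff_subset] at h
    exact hne (Finset.eq_of_subset_of_card_le h huv.ge)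
  have c1 := Finset.card_le_card hs
  have c2 := Finset.card_union_le (u \ c) (c \ v)
  have c3 := Finset.card_union_le (v \ c) (c \ u)
  have e1 : (u \ v).card = 2 := by omega
  have e2 : (v \ u).card = 2 := by omega
  have f1 := Finset.eq_of_subset_of_card_le hs (by omega)
  have f2 := Finset.eq_of_subset_of_card_le hs' (by omega)
  obtain ⟨x, hx⟩ := Finset.card_eq_one.1 (h1'.trans h1)
  obtain ⟨y, hy⟩ := Finset.card_eq_one.1 h1
  refine ⟨e1, e2, x, by rw [f1, hx]; simp, y, by rw [f2, hy]; simp, ?_⟩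
  ext z
  have a1 := Finset.ext_iff.1 hx z
  have a2 := Finset.ext_iff.1 hy z
  simp only [Finset.mem_sdiff, Finset.mem_singleton] at a1 a2
  simp only [Finset.mem_insert, Finset.mem_erase]
  tauto

lemma swap_symm {α : Type*} [DecidableEq α] {u v : Finset α} {x x' y y' : α}
    (hx : x ∈ u \ v) (hx' : x' ∈ u \ v) (hy : y ∈ v \ u) (hy' : y' ∈ v \ u)
    (hxx : x ≠ x') (hyy : y ≠ y') :
    (symmDiff (insert y (u.erase x)) (insert y' (u.erase x'))).card ≠ 2 := by
  simp only [Finset.mem_sdiff] at *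
  have hs : ({x, x', y} : Finset α) ⊆
      symmDiff (insert y (u.erase x)) (insert y' (u.erase x')) := by
    intro z
    simp only [Finset.mem_symmDiff, Finset.mem_insert, Finset.mem_erase, Finset.mem_singleton]
    grind
  have := Finset.card_le_card hs
  have : ({x, x', y} : Finset α).card = 3 := by
    rw [Finset.card_eq_three]
    exact ⟨x, x', y, hxx, by grind, by grind, rfl⟩
  omega

lemma no_triangle {α : Type*} [DecidableEq α] {u v c d e : Finset α} (huv : u.card = v.card)
    (huc : u.card = c.card) (hud : u.card = d.card) (hue : u.card = e.card)
    (hne : u ≠ v) (hna : (symmDiff u v).card ≠ 2)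
    (c1 : (symmDiff c u).card = 2) (c2 : (symmDiff c v).card = 2)
    (d1 : (symmDiff d u).card = 2) (d2 : (symmDiff d v).card = 2)
    (e1 : (symmDiff e u).card = 2) (e2 : (symmDiff e v).card = 2)
    (cd : (symmDiff c d).card = 2) (ce : (symmDiff c e).card = 2)
    (de : (symmDiff d e).card = 2) : False := by
  obtain ⟨p, q, x, hx, y, hy, rfl⟩ := common_nbr huv huc hne hna c1 c2
  obtain ⟨-, -, x', hx', y', hy', rfl⟩ := common_nbr huv hud hne hna d1 d2
  obtain ⟨-, -, x'', hx'', y'', hy'', rfl⟩ := common_nbr huv hue hne hna e1 e2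
  have k1 := fun h h' => swap_symm hx hx' hy hy' h h' cd
  have k2 := fun h h' => swap_symm hx hx'' hy hy'' h h' ce
  have k3 := fun h h' => swap_symm hx' hx'' hy' hy'' h h' de
  have n1 : ¬ (x = x' ∧ y = y') := by rintro ⟨rfl, rfl⟩; simp at cd
  have n2 : ¬ (x = x'' ∧ y = y'') := by rintro ⟨rfl, rfl⟩; simp at ce
  have n3 : ¬ (x' = x'' ∧ y' = y'') := by rintro ⟨rfl, rfl⟩; simp at de
  obtain ⟨s, t, hst, hp⟩ := Finset.card_eq_two.1 p
  obtain ⟨s', t', hst', hq⟩ := Finset.card_eq_two.1 q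
  rw [hp] at hx hx' hx''
  rw [hq] at hy hy' hy''
  simp only [Finset.mem_insert, Finset.mem_singleton] at hx hx' hx'' hy hy' hy''
  grind

lemma shatter_mono {V : Type*} {G : SimpleGraph V} {A B : Set V} (h : edgeShatters G A)
    (hBA : B ⊆ A) : edgeShatters G B := by
  intro C hC
  obtain ⟨w, hw⟩ := h C (hC.trans hBA)
  refine ⟨w, ?_⟩
  ext z
  have := Set.ext_iff.1 hw z
  have h1 := @hBA z
  have h2 := @hC z
  simp only [Set.mem_inter_iff] at *
  tauto

lemma shatter_fun {V : Type*} [DecidableEq V] {G : SimpleGraph V} {A : Finset V}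
    (h : edgeShatters G (A : Set V)) : ∃ f : Finset V → V,
      ∀ B ⊆ A, ∀ z ∈ A, G.Adj (f B) z ↔ z ∈ B := by
  have : ∀ B : Finset V, ∃ w, B ⊆ A → ∀ z ∈ A, G.Adj w z ↔ z ∈ B := by
    intro B
    by_cases hB : B ⊆ A
    · obtain ⟨w, hw⟩ := h (B : Set V) (by exact_mod_cast hB)
      refine ⟨w, fun _ z hz => ?_⟩
      have := Set.ext_iff.1 hw z
      simp only [Set.mem_inter_iff, Finset.mem_coe, SimpleGraph.mem_neighborSet] at this
      tauto
    · obtain ⟨w, -⟩ := h ∅ (by simp)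
      exact ⟨w, fun h => absurd h hB⟩
  choose f hf using this
  exact ⟨f, hf⟩

lemma fun_inj {V : Type*} [DecidableEq V] {G : SimpleGraph V} {A : Finset V} {f : Finset V → V}
    (hf : ∀ B ⊆ A, ∀ z ∈ A, G.Adj (f B) z ↔ z ∈ B) {B C : Finset V} (hB : B ⊆ A) (hC : C ⊆ A)
    (h : f B = f C) : B = C := by
  ext z
  by_cases hz : z ∈ A
  · rw [← hf B hB z hz, h, hf C hC z hz]
  · exact ⟨fun h => absurd (hB h) hz, fun h => absurd (hC h) hz⟩

lemma no_five (m k : ℕ) (A : Finset {s : Finset (Fin m) // s.card = k}) (hA : A.card = 5)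
    (h : edgeShatters (johnsonGraph m k) (A : Set {s : Finset (Fin m) // s.card = k})) :
    False := by
  obtain ⟨f, hf⟩ := shatter_fun h
  have clique : ∀ a ∈ A, ∀ b ∈ A, a ≠ b → (johnsonGraph m k).Adj a b := by
    intro a ha b hb hab
    by_contra hna
    have hsub : ({a, b} : Finset _) ⊆ A := by
      intro z hz
      simp only [Finset.mem_insert, Finset.mem_singleton] at hz
      rcases hz with rfl | rfl <;> assumption
    have hc : (A \ {a, b}).card = 3 := by
      rw [Finset.card_sdiff_of_subset hsub, Finset.card_pair hab, hA]
    have hval : a.1 ≠ b.1 := fun h => hab (Subtype.ext h)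
    have hS : ∀ S ∈ (A \ {a, b}).powerset, ({a, b} ∪ S) ⊆ A := by
      intro S hS
      exact Finset.union_subset hsub ((Finset.mem_powerset.1 hS).trans Finset.sdiff_subset)
    have key : ∀ S ∈ (A \ {a, b}).powerset, _ := fun S hS' =>
      common_nbr (c := (f ({a, b} ∪ S)).1) (a.2.trans b.2.symm)
        (a.2.trans (f ({a, b} ∪ S)).2.symm) hval hna
        ((hf _ (hS S hS') a ha).2 (by simp)) ((hf _ (hS S hS') b hb).2 (by simp))
    have hle : (A \ {a, b}).powerset.card ≤
        (((a.1 \ b.1) ×ˢ (b.1 \ a.1)).image (fun p => insert p.2 (a.1.erase p.1))).card := by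
      apply Finset.card_le_card_of_injOn (fun S => (f ({a, b} ∪ S)).1)
      · intro S hS'
        obtain ⟨-, -, x, hx, y, hy, e⟩ := key S hS'
        simp only [Finset.coe_image, Set.mem_image]
        exact ⟨(x, y), Finset.mem_coe.2 (Finset.mem_product.2 ⟨hx, hy⟩), e.symm⟩
      · intro S hS1 T hT1 e
        have e' := fun_inj hf (hS S hS1) (hS T hT1) (Subtype.ext e)
        have s1 := Finset.mem_powerset.1 hS1
        have t1 := Finset.mem_powerset.1 hT1
        ext z
        have := Finset.ext_iff.1 e' z
        have s2 := @s1 z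
        have t2 := @t1 z
        simp only [Finset.mem_union, Finset.mem_sdiff] at *
        tauto
    obtain ⟨p, q, -⟩ := key ∅ (by simp)
    have := hle.trans Finset.card_image_le
    rw [Finset.card_product, p, q, Finset.card_powerset, hc] at this
    omega
  obtain ⟨B, hBA, hB⟩ := Finset.exists_subset_card_eq (s := A) (n := 3) (by omega)
  have hd : (A \ B).card = 2 := by rw [Finset.card_sdiff_of_subset hBA]; omega
  obtain ⟨v, hv, hvw⟩ := Finset.exists_mem_ne (s := A \ B) (by omega) (f B)
  obtain ⟨c, d, e, hcd, hce, hde, rfl⟩ := Finset.card_eq_three.1 hB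
  set B : Finset {s : Finset (Fin m) // s.card = k} := {c, d, e} with hBd
  rw [Finset.mem_sdiff] at hv
  have mc : c ∈ B := by simp [hBd]
  have md : d ∈ B := by simp [hBd]
  have me : e ∈ B := by simp [hBd]
  have nv : ∀ z ∈ B, z ≠ v := by rintro z hz rfl; exact hv.2 hz
  exact no_triangle (u := (f B).1) (v := v.1) (c := c.1) (d := d.1) (e := e.1)
    ((f B).2.trans v.2.symm) ((f B).2.trans c.2.symm) ((f B).2.trans d.2.symm)
    ((f B).2.trans e.2.symm) (fun h => hvw (Subtype.ext h.symm))
    (fun h => hv.2 ((hf B hBA v hv.1).1 h))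
    ((hf B hBA c (hBA mc)).2 mc).symm (clique c (hBA mc) v hv.1 (nv c mc))
    ((hf B hBA d (hBA md)).2 md).symm (clique d (hBA md) v hv.1 (nv d md))
    ((hf B hBA e (hBA me)).2 me).symm (clique e (hBA me) v hv.1 (nv e me))
    (clique c (hBA mc) d (hBA md) hcd) (clique c (hBA mc) e (hBA me) hce)
    (clique d (hBA md) e (hBA me) hde)

/-- A convenient form of: some 4-set is shattered in `J(m,k)`. -/
def JP (m k : ℕ) : Prop := ∃ a : Fin 4 → Finset (Fin m), (∀ i, (a i).card = k) ∧
  ∀ S : Finset (Fin 4), ∃ w : Finset (Fin m), w.card = k ∧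
    ∀ i, (symmDiff w (a i)).card = 2 ↔ i ∈ S

lemma bits : ∀ S : Finset (Fin 4), ∃ b : Fin 16, ∀ i : Fin 4,
    Nat.testBit b.1 i.1 = true ↔ i ∈ S := by decide

lemma jp_of_table (m k : ℕ) (a : Fin 4 → Finset (Fin m)) (w : Fin 16 → Finset (Fin m))
    (ha : ∀ i, (a i).card = k) (hw : ∀ b, (w b).card = k)
    (h : ∀ b i, (symmDiff (w b) (a i)).card = 2 ↔ Nat.testBit b.1 i.1 = true) : JP m k := by
  refine ⟨a, ha, fun S => ?_⟩
  obtain ⟨b, hb⟩ := bits S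
  exact ⟨w b, hw b, fun i => (h b i).trans (hb i)⟩

lemma jbase72 : JP 7 2 :=
  jp_of_table 7 2 ![{0, 1}, {0, 2}, {0, 3}, {0, 4}]
    ![{5, 6}, {1, 5}, {2, 5}, {1, 2}, {3, 5}, {1, 3}, {2, 3}, {0, 4}, {4, 5}, {1, 4}, {2, 4}, {0, 3}, {3, 4}, {0, 2}, {0, 1}, {0, 5}]
    (by decide) (by decide) (by decide)

lemma jbase63 : JP 6 3 :=
  jp_of_table 6 3 ![{0, 1, 2}, {0, 1, 3}, {0, 2, 4}, {0, 3, 5}]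
    ![{1, 4, 5}, {0, 2, 4}, {0, 3, 5}, {1, 2, 3}, {2, 3, 4}, {1, 2, 4}, {0, 1, 2}, {0, 1, 4}, {2, 3, 5}, {0, 1, 3}, {1, 3, 5}, {0, 1, 5}, {0, 4, 5}, {0, 2, 5}, {0, 3, 4}, {0, 2, 3}]
    (by decide) (by decide) (by decide)

lemma jbase75 : JP 7 5 :=
  jp_of_table 7 5 ![{0, 1, 2, 3, 4}, {0, 1, 2, 3, 5}, {0, 1, 2, 4, 5}, {0, 1, 3, 4, 5}]
    ![{2, 3, 4, 5, 6}, {0, 2, 3, 4, 6}, {0, 2, 3, 5, 6}, {0, 1, 2, 3, 6}, {0, 2, 4, 5, 6}, {0, 1, 2, 4, 6}, {0, 1, 2, 5, 6}, {0, 1, 3, 4, 5}, {0, 3, 4, 5, 6}, {0, 1, 3, 4, 6}, {0, 1, 3, 5, 6}, {0, 1, 2, 4, 5}, {0, 1, 4, 5, 6}, {0, 1, 2, 3, 5}, {0, 1, 2, 3, 4}, {0, 2, 3, 4, 5}]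
    (by decide) (by decide) (by decide)

lemma jmap_symm {m : ℕ} (s t : Finset (Fin m)) :
    (symmDiff (s.map Fin.castSuccEmb) (t.map Fin.castSuccEmb)).card = (symmDiff s t).card := by
  rw [← Finset.card_map (s := symmDiff s t) Fin.castSuccEmb]
  congr 1
  simp only [Finset.map_eq_image]
  exact (Finset.image_symmDiff s t Fin.castSuccEmb.injective).symm

lemma jp_succ {m k : ℕ} (h : JP m k) : JP (m + 1) k := by
  obtain ⟨a, ha, h⟩ := h
  refine ⟨fun i => (a i).map Fin.castSuccEmb, fun i => by rw [Finset.card_map, ha], fun S => ?_⟩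
  obtain ⟨w, hw, hS⟩ := h S
  refine ⟨w.map Fin.castSuccEmb, by rw [Finset.card_map, hw], fun i => ?_⟩
  rw [← hS i]
  simp only [jmap_symm]

lemma insert_symm {α : Type*} [DecidableEq α] {s t : Finset α} {x : α} (hs : x ∉ s) (ht : x ∉ t) :
    symmDiff (insert x s) (insert x t) = symmDiff s t := by
  ext z
  simp only [Finset.mem_symmDiff, Finset.mem_insert]
  by_cases h : z = x
  · subst h; tauto
  · tauto

lemma jp_succ_succ {m k : ℕ} (h : JP m k) : JP (m + 1) (k + 1) := by
  obtain ⟨a, ha, h⟩ := h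
  have hl : ∀ s : Finset (Fin m), Fin.last m ∉ s.map Fin.castSuccEmb := by
    intro s hs
    obtain ⟨y, -, hy⟩ := Finset.mem_map.1 hs
    exact (Fin.castSucc_lt_last y).ne hy
  refine ⟨fun i => insert (Fin.last m) ((a i).map Fin.castSuccEmb), fun i => by
    rw [Finset.card_insert_of_notMem (hl _), Finset.card_map, ha], fun S => ?_⟩
  obtain ⟨w, hw, hS⟩ := h S
  refine ⟨insert (Fin.last m) (w.map Fin.castSuccEmb), by
    rw [Finset.card_insert_of_notMem (hl _), Finset.card_map, hw], fun i => ?_⟩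
  rw [← hS i, insert_symm (hl _) (hl _), jmap_symm]

lemma jp_up {m k : ℕ} (h : JP m k) (i j : ℕ) : JP (m + i + j) (k + j) := by
  have h1 : JP (m + i) k := by
    induction i with
    | zero => exact h
    | succ i ih => exact jp_succ ih
  induction j with
  | zero => exact h1
  | succ j ih => exact jp_succ_succ ih

lemma jp_of (m k : ℕ) (h1 : 1 < k) (h2 : k < m - 1) (h3 : 16 ≤ m.choose k) : JP m k := by
  have up : ∀ m' k', JP m' k' → k' ≤ k → m' + k ≤ m + k' → JP m k := by
    intro m' k' h a b
    have := jp_up h (m + k' - (m' + k)) (k - k')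
    have e1 : m' + (m + k' - (m' + k)) + (k - k') = m := by omega
    have e2 : k' + (k - k') = k := by omega
    rwa [e1, e2] at this
  by_cases c1 : 7 + k ≤ m + 2
  · exact up 7 2 jbase72 (by omega) c1
  by_cases c2 : 3 ≤ k ∧ 6 + k ≤ m + 3
  · exact up 6 3 jbase63 c2.1 c2.2
  by_cases c3 : 5 ≤ k
  · exact up 7 5 jbase75 c3 (by omega)
  exfalso
  have hm : m ≤ 6 := by omega
  have hk : k ≤ 4 := by omega
  interval_cases m <;> interval_cases k <;> first | omega | (revert h3; decide)

lemma shatter_of_jp {m k : ℕ} (h : JP m k) :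
    ∃ A : Finset {s : Finset (Fin m) // s.card = k}, A.card = 4 ∧
      edgeShatters (johnsonGraph m k) (A : Set {s : Finset (Fin m) // s.card = k}) := by
  obtain ⟨a, ha, h⟩ := h
  let g : Fin 4 → {s : Finset (Fin m) // s.card = k} := fun i => ⟨a i, ha i⟩
  have hg : Function.Injective g := by
    intro i j hij
    have e : a i = a j := congrArg Subtype.val hij
    obtain ⟨w, -, hS⟩ := h {j}
    have h1 := (hS j).2 (by simp)
    rw [← e] at h1
    simpa using (hS i).1 h1
  refine ⟨Finset.univ.map ⟨g, hg⟩, by simp, ?_⟩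
  intro B hB
  classical
  obtain ⟨w, hw, hS⟩ := h (Finset.univ.filter (fun i => g i ∈ B))
  refine ⟨⟨w, hw⟩, ?_⟩
  have key : ∀ i, (johnsonGraph m k).Adj ⟨w, hw⟩ (g i) ↔ g i ∈ B := by
    intro i
    have := hS i
    rw [Finset.mem_filter_univ] at this
    exact this
  ext z
  constructor
  · rintro ⟨h1, h2⟩
    obtain ⟨i, -, rfl⟩ := Finset.mem_map.1 (Finset.mem_coe.1 h1)
    exact (key i).1 h2
  · intro hz
    refine ⟨hB hz, ?_⟩
    obtain ⟨i, -, rfl⟩ := Finset.mem_map.1 (Finset.mem_coe.1 (hB hz))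
    exact (key i).2 hz

lemma shatter_conv {m k : ℕ} (hk : k ≤ m) (A : Finset {s : Finset (Fin m) // s.card = k})
    (hA : A.card = 4)
    (h : edgeShatters (johnsonGraph m k) (A : Set {s : Finset (Fin m) // s.card = k})) :
    1 < k ∧ k < m - 1 ∧ 16 ≤ m.choose k := by
  obtain ⟨f, hf⟩ := shatter_fun h
  obtain ⟨v, hv, hvw⟩ := Finset.exists_mem_ne (s := A) (by omega) (f ∅)
  have hna : ¬ (symmDiff (f ∅).1 v.1).card = 2 := fun h' => by
    simpa using (hf ∅ (by simp) v hv).1 h'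
  have cf := (f ∅).2
  have cv := v.2
  rw [symm_card (cf.trans cv.symm)] at hna
  have h0 : ((f ∅).1 \ v.1).card ≠ 0 := by
    intro h
    rw [Finset.card_eq_zero, Finset.sdiff_eq_empty_iff_subset] at h
    exact hvw (Subtype.ext (Finset.eq_of_subset_of_card_le h (by omega)).symm)
  have l1 := Finset.card_le_card (Finset.sdiff_subset (s := (f ∅).1) (t := v.1))
  have l2 : ((f ∅).1 \ v.1).card ≤ (v.1)ᶜ.card :=
    Finset.card_le_card (by intro z; simp)
  rw [Finset.card_compl, Fintype.card_fin] at l2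
  refine ⟨by omega, by omega, ?_⟩
  have := Finset.card_le_card_of_injOn (s := A.powerset) (t := Finset.univ) f (by simp)
    (fun B hB C hC e => fun_inj hf (Finset.mem_powerset.1 hB) (Finset.mem_powerset.1 hC) e)
  rw [Finset.card_powerset, hA, Finset.card_univ, Fintype.card_finset_len, Fintype.card_fin] at this
  omega

/-- The VC-dimension of the edge relation of the Johnson graph `J(m,k)` is exactly `4`
iff `1 < k < m - 1` and `J(m,k)` has at least `16` vertices. -/
theorem johnson_vc_dim_eq_four_iff (m k : ℕ) (hk : k ≤ m) :
    edgeVCDim (johnsonGraph m k) = 4 ↔ (1 < k ∧ k < m - 1 ∧ 16 ≤ m.choose k) := by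
  have hub : ∀ n ∈ {n | ∃ A : Finset {s : Finset (Fin m) // s.card = k}, A.card = n ∧
      edgeShatters (johnsonGraph m k) ↑A}, n ≤ 4 := by
    rintro n ⟨A, rfl, hA⟩
    by_contra hn
    obtain ⟨B, hBA, hB⟩ := Finset.exists_subset_card_eq (s := A) (n := 5) (by omega)
    exact no_five m k B hB (shatter_mono hA (by exact_mod_cast hBA))
  constructor
  · intro h
    have hne : {n | ∃ A : Finset {s : Finset (Fin m) // s.card = k}, A.card = n ∧
        edgeShatters (johnsonGraph m k) ↑A}.Nonempty := by
      by_contra hne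
      rw [Set.not_nonempty_iff_eq_empty] at hne
      rw [edgeVCDim, hne] at h
      simp at h
    have hmem := Nat.sSup_mem hne ⟨4, hub⟩
    change edgeVCDim (johnsonGraph m k) ∈ _ at hmem
    rw [h] at hmem
    obtain ⟨A, hA, hs⟩ := hmem
    exact shatter_conv hk A hA hs
  · rintro ⟨h1, h2, h3⟩
    have hmem := shatter_of_jp (jp_of m k h1 h2 h3)
    exact le_antisymm (csSup_le ⟨4, hmem⟩ hub) (le_csSup ⟨4, hub⟩ hmem)
end

section
/- For natural numbers d and q, the VC-dimension of the edge relation on the Hamming graph H(d,q) equals 3 if and only if at least one of the following holds: (1) d ≥ 3 and q ≥ 3; (2) d ≥ 2 and q ≥ 4; (3) d ≥ 4 and q ≥ 2. -/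
open SimpleGraph

/-- The Hamming graph `H(d,q)`. -/
def hammingGraph (d q : ℕ) : SimpleGraph (Fin d → Fin q) where
  Adj u v := hammingDist u v = 1
  symm := by
    constructor
    intro u v h
    rwa [hammingDist_comm]
  loopless := by
    constructor
    intro u h
    simp [hammingDist_self] at h

theorem adj1 {d q : ℕ} (u v : Fin d → Fin q) :
    hammingDist u v = 1 ↔ ∃ i, u i ≠ v i ∧ ∀ j, j ≠ i → u j = v j := by
  unfold hammingDist
  rw [Finset.card_eq_one]
  constructor
  · rintro ⟨i, hi⟩
    simp only [Finset.ext_iff, Finset.mem_filter, Finset.mem_univ, true_and,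
      Finset.mem_singleton] at hi
    exact ⟨i, (hi i).2 rfl, fun j hj => by
      by_contra h
      exact hj ((hi j).1 h)⟩
  · rintro ⟨i, h1, h2⟩
    refine ⟨i, ?_⟩
    ext j
    simp only [Finset.mem_filter, Finset.mem_univ, true_and, Finset.mem_singleton]
    constructor
    · intro h
      by_contra hj
      exact h (h2 j hj)
    · rintro rfl
      exact h1

theorem lineL1 {d q : ℕ} {w x y : Fin d → Fin q} {i : Fin d}
    (hx : hammingDist w x = 1) (hy : hammingDist w y = 1) (hne : x ≠ y)
    (h : ∀ j, j ≠ i → x j = y j) : ∀ j, j ≠ i → w j = x j := by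
  obtain ⟨a, ha, ha'⟩ := (adj1 _ _).1 hx
  obtain ⟨b, hb, hb'⟩ := (adj1 _ _).1 hy
  intro j hj
  by_contra hw
  have e1 : j = a := by
    by_contra hh
    exact hw (ha' j hh)
  have e2 : j = b := by
    by_contra hh
    exact hw ((hb' j hh).trans (h j hj).symm)
  subst e1
  subst e2
  apply hne
  funext k
  by_cases hk : k = j
  · subst hk
    exact h k hj
  · rw [← ha' k hk, ← hb' k hk]

theorem lineL2aux {d q : ℕ} {w w' x y z : Fin d → Fin q} {i : Fin d}
    (hxy : x ≠ y) (hw : w ≠ w') (hz : hammingDist w z = 1)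
    (hx' : hammingDist w' x = 1) (hy' : hammingDist w' y = 1) (hz' : hammingDist w' z = 1)
    (hi : ∀ j, j ≠ i → w j = x j) (hj : ∀ j, j ≠ i → w j = y j) :
    ∀ j, j ≠ i → w j = x j ∧ w j = y j ∧ w j = z j := by
  have h1 := lineL1 (i := i) hx' hy' hxy (fun j h => (hi j h).symm.trans (hj j h))
  have h2 := lineL1 (i := i) (w := z) (x := w) (y := w') (by rwa [hammingDist_comm])
    (by rwa [hammingDist_comm]) hw (fun j h => (hi j h).trans (h1 j h).symm)
  exact fun j h => ⟨hi j h, hj j h, (h2 j h).symm⟩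

theorem lineL2aux2 {d q : ℕ} {w w' x y : Fin d → Fin q} {i j m : Fin d}
    (hij : i ≠ j) (hmi : m ≠ i) (hmj : m ≠ j) (hm : w m ≠ w' m)
    (hx' : hammingDist w' x = 1) (hy' : hammingDist w' y = 1)
    (hi : ∀ l, l ≠ i → w l = x l) (hi0 : w i ≠ x i) (hj : ∀ l, l ≠ j → w l = y l) : False := by
  obtain ⟨a, ha, ha'⟩ := (adj1 _ _).1 hx'
  obtain ⟨b, hb, hb'⟩ := (adj1 _ _).1 hy'
  have e1 : m = a := by
    by_contra hh
    exact hm ((hi m hmi).trans (ha' m hh).symm)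
  have e2 : m = b := by
    by_contra hh
    exact hm ((hj m hmj).trans (hb' m hh).symm)
  subst e1
  subst e2
  exact hi0 (by rw [hj i hij, ← hb' i hmi.symm, ha' i hmi.symm])

theorem lineL2 {d q : ℕ} {w w' x y z : Fin d → Fin q}
    (hxy : x ≠ y) (hxz : x ≠ z) (hyz : y ≠ z) (hw : w ≠ w')
    (hx : hammingDist w x = 1) (hy : hammingDist w y = 1) (hz : hammingDist w z = 1)
    (hx' : hammingDist w' x = 1) (hy' : hammingDist w' y = 1) (hz' : hammingDist w' z = 1) :
    ∃ i, ∀ j, j ≠ i → w j = x j ∧ w j = y j ∧ w j = z j := by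
  obtain ⟨i, hi0, hi⟩ := (adj1 _ _).1 hx
  obtain ⟨j, hj0, hj⟩ := (adj1 _ _).1 hy
  obtain ⟨k, hk0, hk⟩ := (adj1 _ _).1 hz
  by_cases hij : i = j
  · subst hij
    exact ⟨i, lineL2aux hxy hw hz hx' hy' hz' hi hj⟩
  by_cases hik : i = k
  · subst hik
    refine ⟨i, fun l hl => ?_⟩
    have := lineL2aux hxz hw hy hx' hz' hy' hi hk l hl
    tauto
  by_cases hjk : j = k
  · subst hjk
    refine ⟨j, fun l hl => ?_⟩
    have := lineL2aux hyz hw hx hy' hz' hx' hj hk l hl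
    tauto
  exfalso
  obtain ⟨m, hm⟩ := Function.ne_iff.1 hw
  by_cases hmi : m = i
  · subst hmi
    exact lineL2aux2 hjk hij hik hm hy' hz' hj hj0 hk
  by_cases hmj : m = j
  · exact lineL2aux2 hik hmi (by rw [hmj]; exact hjk) hm hx' hz' hi hi0 hk
  exact lineL2aux2 hij hmi hmj hm hx' hy' hi hi0 hj

theorem shat {d q : ℕ} {A : Finset (Fin d → Fin q)} (h : edgeShatters (hammingGraph d q) ↑A)
    (P : (Fin d → Fin q) → Prop) : ∃ w, ∀ a ∈ A, (hammingDist w a = 1 ↔ P a) := by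
  obtain ⟨w, hw⟩ := h {a | a ∈ A ∧ P a} (fun a ha => ha.1)
  refine ⟨w, fun a ha => ?_⟩
  have := Set.ext_iff.1 hw a
  simp only [Set.mem_inter_iff, Finset.mem_coe, ha, true_and, SimpleGraph.mem_neighborSet,
    Set.mem_ofPred_eq] at this
  exact this

theorem card_le3 {d q : ℕ} {A : Finset (Fin d → Fin q)}
    (h : edgeShatters (hammingGraph d q) ↑A) : A.card ≤ 3 := by
  by_contra hc
  obtain ⟨T, hT, hT4⟩ := Finset.exists_subset_card_eq (show 4 ≤ A.card by omega)
  obtain ⟨a, b, c, e, hab, hac, hae, hbc, hbe, hce, rfl⟩ := Finset.card_eq_four.1 hT4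
  have ma : a ∈ A := hT (by simp)
  have mb : b ∈ A := hT (by simp)
  have mc : c ∈ A := hT (by simp)
  have me : e ∈ A := hT (by simp)
  obtain ⟨w0, h0⟩ := shat h (fun _ => True)
  obtain ⟨w1, h1⟩ := shat h (fun t => t ≠ e)
  obtain ⟨w2, h2⟩ := shat h (fun t => t ≠ c)
  obtain ⟨w3, h3⟩ := shat h (fun t => t ≠ c ∧ t ≠ e)
  have n1 : w0 ≠ w1 := by
    rintro rfl
    exact (h1 e me).1 ((h0 e me).2 trivial) rfl
  have n2 : w0 ≠ w2 := by
    rintro rfl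
    exact (h2 c mc).1 ((h0 c mc).2 trivial) rfl
  have z := fun t ht => (h0 t ht).2 trivial
  obtain ⟨i, hi⟩ := lineL2 hab hac hbc n1 (z a ma) (z b mb) (z c mc)
    ((h1 a ma).2 hae) ((h1 b mb).2 hbe) ((h1 c mc).2 hce)
  obtain ⟨i', hi'⟩ := lineL2 hab hae hbe n2 (z a ma) (z b mb) (z e me)
    ((h2 a ma).2 hac) ((h2 b mb).2 hbc) ((h2 e me).2 hce.symm)
  have hii : i' = i := by
    by_contra hne
    apply hab
    funext k
    by_cases hk : k = i
    · have := hi' k (by rw [hk]; exact fun h => hne h.symm)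
      rw [← this.1, ← this.2.1]
    · have := hi k hk
      rw [← this.1, ← this.2.1]
  subst hii
  have w3l := lineL1 (i := i') ((h3 a ma).2 ⟨hac, hae⟩) ((h3 b mb).2 ⟨hbc, hbe⟩) hab
    (fun j hj => (hi j hj).1.symm.trans (hi j hj).2.1)
  have key : ∀ t, (∀ j, j ≠ i' → w3 j = t j) → ¬ hammingDist w3 t = 1 → w3 = t := by
    intro t ht hn
    by_contra hne
    apply hn
    rw [adj1]
    refine ⟨i', fun he => hne ?_, ht⟩
    funext k
    by_cases hk : k = i'
    · rw [hk, he]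
    · exact ht k hk
  have k1 := key c (fun j hj => by rw [w3l j hj, ← (hi j hj).1, (hi j hj).2.2])
    (by rw [h3 c mc]; simp)
  have k2 := key e (fun j hj => by rw [w3l j hj, ← (hi j hj).1, (hi' j hj).2.2])
    (by rw [h3 e me]; simp)
  exact hce (k1.symm.trans k2)

def Sh3 (d q : ℕ) (x y z : Fin d → Fin q) : Prop :=
  x ≠ y ∧ x ≠ z ∧ y ≠ z ∧ ∀ b1 b2 b3 : Bool, ∃ w : Fin d → Fin q,
    (hammingDist w x = 1 ↔ b1 = true) ∧ (hammingDist w y = 1 ↔ b2 = true) ∧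
    (hammingDist w z = 1 ↔ b3 = true)

theorem vc_iff (d q : ℕ) : edgeVCDim (hammingGraph d q) = 3 ↔ ∃ x y z, Sh3 d q x y z := by
  have hb : BddAbove {n | ∃ A : Finset (Fin d → Fin q),
      A.card = n ∧ edgeShatters (hammingGraph d q) ↑A} := by
    refine ⟨3, ?_⟩
    rintro n ⟨A, rfl, hA⟩
    exact card_le3 hA
  constructor
  · intro h
    have hmem : 3 ∈ {n | ∃ A : Finset (Fin d → Fin q),
        A.card = n ∧ edgeShatters (hammingGraph d q) ↑A} := by
      rw [← h]
      refine Nat.sSup_mem ?_ hb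
      by_contra hne
      rw [Set.not_nonempty_iff_eq_empty] at hne
      unfold edgeVCDim at h
      rw [hne] at h
      simp at h
    obtain ⟨A, hA, hs⟩ := hmem
    obtain ⟨x, y, z, hxy, hxz, hyz, rfl⟩ := Finset.card_eq_three.1 hA
    refine ⟨x, y, z, hxy, hxz, hyz, fun b1 b2 b3 => ?_⟩
    obtain ⟨w, hw⟩ := shat hs (fun t => (t = x ∧ b1 = true) ∨ (t = y ∧ b2 = true) ∨
      (t = z ∧ b3 = true))
    refine ⟨w, ?_, ?_, ?_⟩
    · rw [hw x (by simp)]; simp [hxy, hxz]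
    · rw [hw y (by simp)]; simp [hxy.symm, hyz]
    · rw [hw z (by simp)]; simp [hxz.symm, hyz.symm]
  · rintro ⟨x, y, z, hxy, hxz, hyz, h⟩
    apply le_antisymm
    · apply csSup_le'
      rintro n ⟨A, rfl, hA⟩
      exact card_le3 hA
    · apply le_csSup hb
      refine ⟨{x, y, z}, Finset.card_eq_three.2 ⟨x, y, z, hxy, hxz, hyz, rfl⟩, ?_⟩
      intro B hB
      classical
      obtain ⟨w, h1, h2, h3⟩ := h (decide (x ∈ B)) (decide (y ∈ B)) (decide (z ∈ B))
      simp only [decide_eq_true_eq] at h1 h2 h3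
      refine ⟨w, ?_⟩
      ext t
      have hn : t ∈ (hammingGraph d q).neighborSet w ↔ hammingDist w t = 1 := Iff.rfl
      rw [Set.mem_inter_iff, hn]
      constructor
      · rintro ⟨ht, ha⟩
        simp only [Finset.coe_insert, Finset.coe_singleton, Set.mem_insert_iff,
          Set.mem_singleton_iff] at ht
        rcases ht with rfl | rfl | rfl
        · exact h1.1 ha
        · exact h2.1 ha
        · exact h3.1 ha
      · intro ht
        refine ⟨hB ht, ?_⟩
        have ht' := hB ht
        simp only [Finset.coe_insert, Finset.coe_singleton, Set.mem_insert_iff,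
          Set.mem_singleton_iff] at ht'
        rcases ht' with rfl | rfl | rfl
        · exact h1.2 ht
        · exact h2.2 ht
        · exact h3.2 ht

def emb {d q d' q' : ℕ} (hq : q ≤ q') (h0 : 0 < q') (v : Fin d → Fin q) : Fin d' → Fin q' :=
  fun i => if h : i.1 < d then Fin.castLE hq (v ⟨i.1, h⟩) else ⟨0, h0⟩

theorem emb_dist {d q d' q' : ℕ} (hd : d ≤ d') (hq : q ≤ q') (h0 : 0 < q')
    (u v : Fin d → Fin q) :
    hammingDist (emb hq h0 u : Fin d' → Fin q') (emb hq h0 v) = hammingDist u v := by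
  unfold hammingDist
  symm
  apply Finset.card_bij (fun i _ => Fin.castLE hd i)
  · intro i hi
    rw [Finset.mem_filter] at hi ⊢
    exact ⟨Finset.mem_univ _, by simpa [emb] using hi.2⟩
  · intro i _ j _ h
    simpa using h
  · intro i hi
    rw [Finset.mem_filter] at hi
    by_cases h : i.1 < d
    · exact ⟨⟨i.1, h⟩, by
        rw [Finset.mem_filter]
        exact ⟨Finset.mem_univ _, by simpa [emb, h] using hi.2⟩, by ext; simp⟩
    · exact absurd hi.2 (by simp [emb, h])

theorem emb_sh {d q d' q' : ℕ} (hd : d ≤ d') (hq : q ≤ q') (h0 : 0 < q')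
    (x y z : Fin d → Fin q) (h : Sh3 d q x y z) : ∃ x y z, Sh3 d' q' x y z := by
  have hne : ∀ u v : Fin d → Fin q, u ≠ v →
      (emb hq h0 u : Fin d' → Fin q') ≠ emb hq h0 v := by
    intro u v huv he
    rw [← hammingDist_eq_zero, emb_dist hd, hammingDist_eq_zero] at he
    exact huv he
  obtain ⟨h1, h2, h3, h4⟩ := h
  refine ⟨emb hq h0 x, emb hq h0 y, emb hq h0 z, hne _ _ h1, hne _ _ h2, hne _ _ h3, ?_⟩
  intro b1 b2 b3
  obtain ⟨w, hw⟩ := h4 b1 b2 b3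
  exact ⟨emb hq h0 w, by simpa only [emb_dist hd] using hw⟩

theorem sh33 : Sh3 3 3 ![1,0,0] ![0,1,0] ![0,0,1] := by
  unfold Sh3; decide +kernel
theorem sh24 : Sh3 2 4 ![1,0] ![2,0] ![3,0] := by
  unfold Sh3; decide +kernel
theorem sh42 : Sh3 4 2 ![1,0,0,0] ![0,1,0,0] ![0,0,1,0] := by
  unfold Sh3; decide +kernel

theorem nsh22 : ¬ ∃ x y z, Sh3 2 2 x y z := by
  unfold Sh3; decide +kernel
theorem nsh23 : ¬ ∃ x y z, Sh3 2 3 x y z := by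
  unfold Sh3; decide +kernel
theorem nsh32 : ¬ ∃ x y z, Sh3 3 2 x y z := by
  unfold Sh3; decide +kernel

/-- The VC-dimension of the edge relation of the Hamming graph `H(d,q)` equals `3`
iff `d ≥ 3` and `q ≥ 3`, or `d ≥ 2` and `q ≥ 4`, or `d ≥ 4` and `q ≥ 2`. -/
theorem hamming_vc_dim_eq_three_iff (d q : ℕ) :
    edgeVCDim (hammingGraph d q) = 3 ↔
      (3 ≤ d ∧ 3 ≤ q) ∨ (2 ≤ d ∧ 4 ≤ q) ∨ (4 ≤ d ∧ 2 ≤ q) := by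
  rw [vc_iff]
  constructor
  · intro hs
    by_contra hc
    have hq : 2 ≤ q := by
      by_contra hq
      obtain ⟨x, y, z, hxy, -⟩ := hs
      apply hxy
      funext i
      have := (x i).2
      have := (y i).2
      apply Fin.ext
      omega
    have hd : 2 ≤ d := by
      by_contra hd
      obtain ⟨x, y, z, hxy, -, -, h⟩ := hs
      obtain ⟨w, h1, h2, -⟩ := h false false false
      have key : ∀ t : Fin d → Fin q, (hammingDist w t = 1 ↔ false = true) → w = t := by
        intro t ht
        funext i
        by_contra hne
        have : hammingDist w t = 1 := by
          rw [adj1]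
          refine ⟨i, hne, fun j hj => absurd (Fin.ext ?_) hj⟩
          have := i.2
          have := j.2
          omega
        simp [this] at ht
      exact hxy ((key x h1).symm.trans (key y h2))
    have : (d = 2 ∧ q = 2) ∨ (d = 2 ∧ q = 3) ∨ (d = 3 ∧ q = 2) := by omega
    rcases this with ⟨rfl, rfl⟩ | ⟨rfl, rfl⟩ | ⟨rfl, rfl⟩
    · exact nsh22 hs
    · exact nsh23 hs
    · exact nsh32 hs
  · rintro (⟨h1, h2⟩ | ⟨h1, h2⟩ | ⟨h1, h2⟩)
    · exact emb_sh h1 h2 (by omega) _ _ _ sh33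
    · exact emb_sh h1 h2 (by omega) _ _ _ sh24
    · exact emb_sh h1 h2 (by omega) _ _ _ sh42
end

section
/- Let d ≥ 2 and q ≥ n be natural numbers. Then there exists a set A of n vertices of the Hamming graph H(d,q), all of whose elements pairwise agree in every coordinate except the first two (and pairwise differ in both of the first two coordinates), such that for every 2-element subset {u,v} of A there exists a vertex w of H(d,q) with N(w) ∩ A = {u,v}. Consequently the number of distinct traces on A is at least n(n−1)/2, so the VC-density of the edge relation on the class of Hamming graphs is at least 2. -/
open SimpleGraph

theorem hammingDist_aux (m q : ℕ) (w v : Fin (m+2) → Fin q)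
    (h : ∀ j : Fin m, w j.succ.succ = v j.succ.succ) :
    hammingDist w v = (if w 0 ≠ v 0 then 1 else 0) + (if w 1 ≠ v 1 then 1 else 0) := by
  unfold hammingDist
  rw [Finset.card_filter, Fin.sum_univ_succ, Fin.sum_univ_succ]
  simp [h]
  split_ifs <;> simp_all

/-- Lower bound witnessing that the VC-density of the edge relation on the class of
Hamming graphs is at least `2`: for `d ≥ 2` and `q ≥ n` there is a set `A` of `n` vertices
of `H(d,q)`, pairwise agreeing in every coordinate except the first two and pairwise
differing in both of the first two coordinates, every pair of which is cut out as the
trace of a neighbourhood, so there are at least `n(n-1)/2` traces on `A`. -/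
theorem hamming_vc_density_lower (d q n : ℕ) (hd : 2 ≤ d) (hq : n ≤ q) :
    ∃ A : Finset (Fin d → Fin q), A.card = n ∧
      (∀ u ∈ A, ∀ v ∈ A, u ≠ v →
        u ⟨0, by omega⟩ ≠ v ⟨0, by omega⟩ ∧ u ⟨1, by omega⟩ ≠ v ⟨1, by omega⟩ ∧
        ∀ j : Fin d, j ≠ ⟨0, by omega⟩ → j ≠ ⟨1, by omega⟩ → u j = v j) ∧
      (∀ u ∈ A, ∀ v ∈ A, u ≠ v →
        ∃ w, (↑A : Set (Fin d → Fin q)) ∩ (hammingGraph d q).neighborSet w = {u, v}) ∧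
      n * (n - 1) / 2 ≤
        {S : Set (Fin d → Fin q) |
          ∃ w, S = (↑A : Set (Fin d → Fin q)) ∩ (hammingGraph d q).neighborSet w}.ncard := by
  obtain ⟨m, rfl⟩ : ∃ m, d = m + 2 := ⟨d - 2, by omega⟩
  let W : Fin n → Fin n → (Fin (m+2) → Fin q) := fun i k j =>
    if j = 0 then Fin.castLE hq i else if j = 1 then Fin.castLE hq k else ⟨0, i.pos.trans_le hq⟩
  have W0 : ∀ i k, W i k 0 = Fin.castLE hq i := fun i k => by simp [W]
  have W1 : ∀ i k, W i k 1 = Fin.castLE hq k := fun i k => by simp [W]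
  have Wj : ∀ i k i' k' (j : Fin (m+2)), j ≠ 0 → j ≠ 1 → W i k j = W i' k' j :=
    fun i k i' k' j h0 h1 => by simp [W, h0, h1]
  have hinj : Function.Injective (fun i => W i i) := by
    intro i k h
    have := congrFun h 0
    simpa [W0] using this
  let A : Finset (Fin (m+2) → Fin q) := Finset.univ.image (fun i => W i i)
  have hcard : A.card = n := by
    simp [A, Finset.card_image_of_injective _ hinj]
  have hA : ∀ u, u ∈ A ↔ ∃ i, W i i = u := fun u => by simp [A]
  have hdist : ∀ i k l, hammingDist (W i k) (W l l)
      = (if i ≠ l then 1 else 0) + (if k ≠ l then 1 else 0) := by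
    intro i k l
    rw [hammingDist_aux]
    · simp [W0, W1]
    · intro j
      exact Wj _ _ _ _ _ (Fin.succ_ne_zero _) (by
        intro h
        have := congrArg Fin.val h
        simp at this)
  have hpair : ∀ u ∈ A, ∀ v ∈ A, u ≠ v →
      ∃ w, (↑A : Set (Fin (m+2) → Fin q)) ∩ (hammingGraph (m+2) q).neighborSet w = {u, v} := by
    intro u hu v hv huv
    obtain ⟨i, rfl⟩ := (hA u).1 hu
    obtain ⟨k, rfl⟩ := (hA v).1 hv
    have hik : i ≠ k := fun h => huv (by rw [h])
    refine ⟨W i k, ?_⟩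
    have hadj : ∀ l, (hammingGraph (m+2) q).Adj (W i k) (W l l) ↔ (l = i ∨ l = k) := by
      intro l
      change hammingDist (W i k) (W l l) = 1 ↔ _
      rw [hdist]
      by_cases h1 : i = l
      · subst h1; simp [hik.symm]
      · by_cases h2 : k = l
        · subst h2; simp [hik]
        · simp [h1, h2, Ne.symm h1, Ne.symm h2]
    ext x
    simp only [Set.mem_inter_iff, Finset.mem_coe, SimpleGraph.mem_neighborSet,
      Set.mem_insert_iff, Set.mem_singleton_iff]
    constructor
    · rintro ⟨hx, hx'⟩
      obtain ⟨l, rfl⟩ := (hA x).1 hx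
      rcases (hadj l).1 hx' with rfl | rfl <;> simp
    · rintro (rfl | rfl)
      · exact ⟨hu, (hadj i).2 (Or.inl rfl)⟩
      · exact ⟨hv, (hadj k).2 (Or.inr rfl)⟩
  refine ⟨A, hcard, ?_, hpair, ?_⟩
  · intro u hu v hv huv
    obtain ⟨i, rfl⟩ := (hA u).1 hu
    obtain ⟨k, rfl⟩ := (hA v).1 hv
    have hik : i ≠ k := fun h => huv (by rw [h])
    refine ⟨?_, ?_, ?_⟩
    · change W i i 0 ≠ W k k 0
      simpa [W0] using hik
    · change W i i 1 ≠ W k k 1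
      simpa [W1] using hik
    · intro j h0 h1
      exact Wj _ _ _ _ _ h0 h1
  · have hc : n * (n - 1) / 2 = ((fun s : Finset (Fin (m+2) → Fin q) =>
        (s : Set (Fin (m+2) → Fin q))) '' (A.powersetCard 2 : Set (Finset _))).ncard := by
      rw [Set.ncard_image_of_injective _ Finset.coe_injective, Set.ncard_coe_finset,
        Finset.card_powersetCard, hcard, Nat.choose_two_right]
    rw [hc]
    apply Set.ncard_le_ncard _ (Set.toFinite _)
    rintro _ ⟨s, hs, rfl⟩
    rw [Finset.mem_coe, Finset.mem_powersetCard] at hs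
    obtain ⟨u, v, huv, rfl⟩ := Finset.card_eq_two.1 hs.2
    obtain ⟨w, hw⟩ := hpair u (hs.1 (by simp)) v (hs.1 (by simp)) huv
    exact ⟨w, by simp [hw]⟩
end
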